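/- Let π: P → H be a surjective map of Hopf algebras over a field k and B := Pᴴ. Equip P⊗B with the right H-coaction p⊗b ↦ p₁⊗b₂ ⊗ π(p₂)π(S(b₁)) (tensor product of the coaction p ↦ p₁⊗π(p₂) on P and b ↦ b₂⊗π(S(b₁)) on B). Then the map B⊗B → (P⊗B)ᴴ, b⊗c ↦ bc₁ ⊗ c₂, is a bijection onto the coinvariant subspace, with inverse induced by p⊗b ↦ pS(b₁) ⊗ b₂; moreover it is an isomorphism of left P-covariant B-bimodules, where B⊗B carries the tensor product left P-coaction and the regular left and right B-actions on the respective factors, and (P⊗B)ᴴ carries the left P-coaction and left B-action from the factor P and the right B-action b'·(p⊗b) := ... (p⊗b)◁b' = pb'₁ ⊗ bb'₂ on the right. -/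

import Mathlib

open TensorProduct CategoryTheory

noncomputable section

/- STATEMENT 15: B ⊗ B ≅ (P ⊗ B)ᴴ, b ⊗ c ↦ bc₁ ⊗ c₂, as left P-covariant
B-bimodules, with inverse induced by p ⊗ b ↦ pS(b₁) ⊗ b₂. -/

section Props
variable {k : Type} [Field k] {H : Type} [Ring H] [HopfAlgebra k H]
variable {A : Type} [Ring A] [Algebra k A]
variable {V : Type} [AddCommGroup V] [Module k V]

/-- `ρ : V → V ⊗ H` is a right `H`-comodule structure. -/
def IsRightCoaction (ρ : V →ₗ[k] V ⊗[k] H) : Prop :=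
  (∀ v, (TensorProduct.rid k V)
      ((LinearMap.lTensor V (Coalgebra.counit (R := k) (A := H))) (ρ v)) = v) ∧
  (∀ v, (LinearMap.rTensor H ρ) (ρ v) =
    (TensorProduct.assoc k V H H).symm
      ((LinearMap.lTensor V (Coalgebra.comul (R := k) (A := H))) (ρ v)))

/-- `lam : V → H ⊗ V` is a left `H`-comodule structure. -/
def IsLeftCoaction (lam : V →ₗ[k] H ⊗[k] V) : Prop :=
  (∀ v, (TensorProduct.lid k V)
      ((LinearMap.rTensor V (Coalgebra.counit (R := k) (A := H))) (lam v)) = v) ∧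
  (∀ v, (LinearMap.lTensor H lam) (lam v) =
    (TensorProduct.assoc k H H V)
      ((LinearMap.rTensor V (Coalgebra.comul (R := k) (A := H))) (lam v)))

/-- `act : V ⊗ A → V` is a right `A`-module structure on the `k`-vector space `V`. -/
def IsRightAction (act : V ⊗[k] A →ₗ[k] V) : Prop :=
  (∀ v, act (v ⊗ₜ (1 : A)) = v) ∧
  (∀ (v : V) (a b : A), act (v ⊗ₜ (a * b)) = act (act (v ⊗ₜ a) ⊗ₜ b))

/-- `act : A ⊗ V → V` is a left `A`-module structure on the `k`-vector space `V`. -/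
def IsLeftAction (act : A ⊗[k] V →ₗ[k] V) : Prop :=
  (∀ v, act ((1 : A) ⊗ₜ v) = v) ∧
  (∀ (a b : A) (v : V), act ((a * b) ⊗ₜ v) = act (a ⊗ₜ act (b ⊗ₜ v)))

end Props

variable {k : Type} [Field k]
variable {P : Type} [Ring P] [HopfAlgebra k P]
variable {H : Type} [Ring H] [HopfAlgebra k H]

/-- The quantum homogeneous space `B = Pᴴ = {p : p₁ ⊗ π(p₂) = p ⊗ 1}`,
as a `k`-subspace of `P`. -/
def qhs (π : P →ₐc[k] H) : Submodule k P :=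
  LinearMap.ker ((LinearMap.lTensor P (π : P →ₗ[k] H)) ∘ₗ
    (Coalgebra.comul (R := k) (A := P)) - (TensorProduct.mk k P H).flip 1)

lemma mem_qhs (π : P →ₐc[k] H) (p : P) :
    p ∈ qhs π ↔ (LinearMap.lTensor P (π : P →ₗ[k] H))
      (Coalgebra.comul (R := k) (A := P) p) = p ⊗ₜ (1 : H) := by
  simp [qhs, sub_eq_zero, LinearMap.mem_ker]

lemma lTensor_pi_eq (π : P →ₐc[k] H) :
    (LinearMap.lTensor P (π : P →ₗ[k] H)) =
      (Algebra.TensorProduct.map (AlgHom.id k P) (π : P →ₐ[k] H)).toLinearMap :=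
  TensorProduct.ext' fun p q => by
    simp [Algebra.TensorProduct.map_tmul]

/-- The quantum homogeneous space `B = Pᴴ` as a subalgebra of `P`. -/
def qhsAlg (π : P →ₐc[k] H) : Subalgebra k P where
  carrier := qhs π
  add_mem' ha hb := (qhs π).add_mem ha hb
  zero_mem' := (qhs π).zero_mem
  one_mem' := by
    rw [SetLike.mem_coe, mem_qhs, Bialgebra.comul_one, Algebra.TensorProduct.one_def]
    simp
  mul_mem' := by
    intro a b ha hb
    rw [SetLike.mem_coe, mem_qhs] at ha hb ⊢
    rw [lTensor_pi_eq] at ha hb ⊢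
    simp only [AlgHom.toLinearMap_apply] at ha hb ⊢
    have hc := map_mul (Bialgebra.comulAlgHom k P) a b
    simp only [Bialgebra.comulAlgHom_apply] at hc
    rw [hc, map_mul, ha, hb, Algebra.TensorProduct.tmul_mul_tmul, one_mul]
  algebraMap_mem' := by
    intro r
    rw [Algebra.algebraMap_eq_smul_one]
    exact (qhs π).smul_mem r (by
      rw [mem_qhs, Bialgebra.comul_one, Algebra.TensorProduct.one_def]
      simp)

/-- The inclusion `B → P` as a `k`-linear map. -/
def qhsIncl (π : P →ₐc[k] H) : (qhsAlg π) →ₗ[k] P := (qhsAlg π).val.toLinearMap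

/-- `coactB : B → P ⊗ B` is the restriction of the comultiplication of `P`
(such a map exists and is unique since `Δ(B) ⊆ P ⊗ B`). -/
def IsRestrictedComul (π : P →ₐc[k] H)
    (coactB : (qhsAlg π) →ₗ[k] P ⊗[k] (qhsAlg π)) : Prop :=
  (LinearMap.lTensor P (qhsIncl π)) ∘ₗ coactB =
    (Coalgebra.comul (R := k) (A := P)) ∘ₗ (qhsIncl π)

/-- The right `H`-coaction `p ↦ p₁ ⊗ π(p₂)` on `P`. -/
def piCoact (π : P →ₐc[k] H) : P →ₗ[k] P ⊗[k] H :=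
  (LinearMap.lTensor P (π : P →ₗ[k] H)) ∘ₗ (Coalgebra.comul (R := k) (A := P))

/-- The map `a ↦ a₂ ⊗ π(S(a₁))` on `P`. -/
def adCoact₀ (π : P →ₐc[k] H) : P →ₗ[k] P ⊗[k] H :=
  (LinearMap.lTensor P ((π : P →ₗ[k] H) ∘ₗ (HopfAlgebra.antipode (R := k) (A := P)))) ∘ₗ
    (TensorProduct.comm k P P).toLinearMap ∘ₗ
    (Coalgebra.comul (R := k) (A := P))

/-- The coinvariants of a right `H`-coaction. -/
def rightCoinv {Y : Type} [AddCommGroup Y] [Module k Y]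
    (ρ : Y →ₗ[k] Y ⊗[k] H) : Submodule k Y :=
  LinearMap.ker (ρ - (TensorProduct.mk k Y H).flip 1)

/-- The tensor product right `H`-coaction on `P ⊗ T`, from `p ↦ p₁ ⊗ π(p₂)`
on `P` and `ρT` on `T`. -/
def prodCoact (π : P →ₐc[k] H) {T : Type} [AddCommGroup T] [Module k T]
    (ρT : T →ₗ[k] T ⊗[k] H) : P ⊗[k] T →ₗ[k] (P ⊗[k] T) ⊗[k] H :=
  (LinearMap.lTensor (P ⊗[k] T) (LinearMap.mul' k H)) ∘ₗ
    (tensorTensorTensorComm k P H T H).toLinearMap ∘ₗ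
    (TensorProduct.map (piCoact π) ρT)

/-- The left `P`-coaction on `P ⊗ T` through the factor `P`: `p ⊗ t ↦ p₁ ⊗ (p₂ ⊗ t)`. -/
def regCoactTensor (T : Type) [AddCommGroup T] [Module k T] :
    P ⊗[k] T →ₗ[k] P ⊗[k] (P ⊗[k] T) :=
  (TensorProduct.assoc k P P T).toLinearMap ∘ₗ
    (LinearMap.rTensor T (Coalgebra.comul (R := k) (A := P)))

/-- The right `B`-action `(p ⊗ t) ◁ b = pb₁ ⊗ t ◁ b₂` on `P ⊗ T`. -/
def prodRact (π : P →ₐc[k] H) (coactB : (qhsAlg π) →ₗ[k] P ⊗[k] (qhsAlg π))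
    {T : Type} [AddCommGroup T] [Module k T]
    (actT : T ⊗[k] (qhsAlg π) →ₗ[k] T) :
    (P ⊗[k] T) ⊗[k] (qhsAlg π) →ₗ[k] P ⊗[k] T :=
  (TensorProduct.map (LinearMap.mul' k P) actT) ∘ₗ
    (tensorTensorTensorComm k P T P (qhsAlg π)).toLinearMap ∘ₗ
    (LinearMap.lTensor (P ⊗[k] T) coactB)

variable (π : P →ₐc[k] H) (coactB : (qhsAlg π) →ₗ[k] P ⊗[k] (qhsAlg π))

/-- Multiplication `B ⊗ P → P`. -/
def qhsMul : (qhsAlg π) ⊗[k] P →ₗ[k] P :=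
  (LinearMap.mul' k P) ∘ₗ (LinearMap.rTensor P (qhsIncl π))

/-- The map `Φ : B ⊗ B → P ⊗ B`, `b ⊗ c ↦ bc₁ ⊗ c₂`. -/
def phiMap : (qhsAlg π) ⊗[k] (qhsAlg π) →ₗ[k] P ⊗[k] (qhsAlg π) :=
  (LinearMap.rTensor (qhsAlg π) (qhsMul π)) ∘ₗ
    (TensorProduct.assoc k (qhsAlg π) P (qhsAlg π)).symm.toLinearMap ∘ₗ
    (LinearMap.lTensor (qhsAlg π) coactB)

/-- The map `Ψ : P ⊗ B → P ⊗ B`, `p ⊗ b ↦ pS(b₁) ⊗ b₂`. -/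
def psiMap : P ⊗[k] (qhsAlg π) →ₗ[k] P ⊗[k] (qhsAlg π) :=
  (LinearMap.rTensor (qhsAlg π) (LinearMap.mul' k P)) ∘ₗ
    (TensorProduct.assoc k P P (qhsAlg π)).symm.toLinearMap ∘ₗ
    (LinearMap.lTensor P
      ((LinearMap.rTensor (qhsAlg π) (HopfAlgebra.antipode (R := k) (A := P))) ∘ₗ coactB))

/-- The left `P`-coaction on `B ⊗ B`: `b ⊗ c ↦ b₁c₁ ⊗ (b₂ ⊗ c₂)`. -/
def lamBB : (qhsAlg π) ⊗[k] (qhsAlg π) →ₗ[k] P ⊗[k] ((qhsAlg π) ⊗[k] (qhsAlg π)) :=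
  (LinearMap.rTensor ((qhsAlg π) ⊗[k] (qhsAlg π)) (LinearMap.mul' k P)) ∘ₗ
    (tensorTensorTensorComm k P (qhsAlg π) P (qhsAlg π)).toLinearMap ∘ₗ
    (TensorProduct.map coactB coactB)

section BBIso

variable {π}

section LeftCoaction

variable {B : Type} [Ring B] [Algebra k B] (δ : B →ₗ[k] P ⊗[k] B)

/-- The map `P ⊗ B → P ⊗ B`, `p ⊗ c ↦ pc₁ ⊗ c₂`. -/
def phiExt : P ⊗[k] B →ₗ[k] P ⊗[k] B :=
  LinearMap.mul' k (P ⊗[k] B) ∘ₗ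
    TensorProduct.map (Algebra.TensorProduct.includeLeft (R := k) (S := k)).toLinearMap δ

@[simp]
lemma phiExt_tmul (p : P) (c : B) :
    phiExt δ (p ⊗ₜ c) = (p ⊗ₜ 1) * δ c := by
  simp [phiExt]

/-- The map `P ⊗ B → P ⊗ B`, `p ⊗ b ↦ pS(b₁) ⊗ b₂`. -/
def psiExt : P ⊗[k] B →ₗ[k] P ⊗[k] B :=
  (LinearMap.rTensor B (LinearMap.mul' k P)) ∘ₗ
    (TensorProduct.assoc k P P B).symm.toLinearMap ∘ₗ
    (LinearMap.lTensor P
      ((LinearMap.rTensor B (HopfAlgebra.antipode (R := k) (A := P))) ∘ₗ δ))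

lemma psiExt_tmul (p : P) (c : B) :
    psiExt δ (p ⊗ₜ c) = (p ⊗ₜ 1) *
      LinearMap.rTensor B (HopfAlgebra.antipode (R := k) (A := P)) (δ c) := by
  simp only [psiExt, LinearMap.comp_apply, LinearMap.lTensor_tmul]
  induction LinearMap.rTensor B (HopfAlgebra.antipode (R := k) (A := P)) (δ c)
    using TensorProduct.induction_on with
  | zero => simp
  | tmul x y => simp
  | add x y hx hy => simp only [tmul_add, map_add, mul_add, hx, hy]

lemma phiExt_mul (p : P) (t : P ⊗[k] B) :
    phiExt δ ((p ⊗ₜ 1) * t) = (p ⊗ₜ 1) * phiExt δ t := by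
  induction t using TensorProduct.induction_on with
  | zero => simp
  | tmul x y => simp [← mul_assoc]
  | add x y hx hy => simp only [map_add, mul_add, hx, hy]

lemma psiExt_mul (p : P) (t : P ⊗[k] B) :
    psiExt δ ((p ⊗ₜ 1) * t) = (p ⊗ₜ 1) * psiExt δ t := by
  induction t using TensorProduct.induction_on with
  | zero => simp
  | tmul x y => simp [psiExt_tmul, ← mul_assoc]
  | add x y hx hy => simp only [map_add, mul_add, hx, hy]

variable {δ}

lemma IsLeftCoaction.counit_rTensor (hδ : IsLeftCoaction (H := P) δ) (b : B) :
    LinearMap.rTensor B (Coalgebra.counit (R := k) (A := P)) (δ b) = (1 : k) ⊗ₜ b := by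
  rw [← (TensorProduct.lid k B).injective.eq_iff, hδ.1, TensorProduct.lid_tmul, one_smul]

lemma psiExt_coaction (hδ : IsLeftCoaction (H := P) δ) (c : B) :
    psiExt δ (δ c) = 1 ⊗ₜ c := by
  have h : (LinearMap.rTensor B (LinearMap.mul' k P)) ∘ₗ
      (TensorProduct.assoc k P P B).symm.toLinearMap ∘ₗ
      (LinearMap.lTensor P
        (LinearMap.rTensor B (HopfAlgebra.antipode (R := k) (A := P)))) ∘ₗ
      (TensorProduct.assoc k P P B).toLinearMap ∘ₗ
        LinearMap.rTensor B (Coalgebra.comul (R := k) (A := P)) =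
      LinearMap.rTensor B (Algebra.linearMap k P) ∘ₗ
        LinearMap.rTensor B (Coalgebra.counit (R := k) (A := P)) := by
    refine TensorProduct.ext' fun p b => ?_
    simp only [LinearMap.comp_apply, LinearMap.rTensor_tmul, Algebra.linearMap_apply,
      ← HopfAlgebra.mul_antipode_lTensor_comul_apply]
    induction Coalgebra.comul (R := k) p using TensorProduct.induction_on with
    | zero => simp
    | tmul x y => simp
    | add x y hx hy => simp only [add_tmul, map_add, hx, hy]
  have h' := LinearMap.congr_fun h (δ c)
  simp only [LinearMap.comp_apply, LinearEquiv.coe_coe, hδ.counit_rTensor, ← hδ.2,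
    LinearMap.rTensor_tmul, Algebra.linearMap_apply, _root_.map_one] at h'
  simpa only [psiExt, LinearMap.lTensor_comp, LinearMap.comp_apply, LinearEquiv.coe_coe] using h'

lemma phiExt_antipode_coaction (hδ : IsLeftCoaction (H := P) δ) (c : B) :
    phiExt δ (LinearMap.rTensor B
      (HopfAlgebra.antipode (R := k) (A := P)) (δ c)) = 1 ⊗ₜ c := by
  have h₁ : phiExt δ ∘ₗ LinearMap.rTensor B
      (HopfAlgebra.antipode (R := k) (A := P)) =
      (LinearMap.rTensor B (LinearMap.mul' k P)) ∘ₗ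
      (TensorProduct.assoc k P P B).symm.toLinearMap ∘ₗ
      LinearMap.rTensor (P ⊗[k] B) (HopfAlgebra.antipode (R := k) (A := P)) ∘ₗ
      LinearMap.lTensor P δ := by
    refine TensorProduct.ext' fun p b => ?_
    simp only [LinearMap.comp_apply, LinearMap.rTensor_tmul, LinearMap.lTensor_tmul, phiExt_tmul]
    induction δ b using TensorProduct.induction_on with
    | zero => simp
    | tmul x y => simp
    | add x y hx hy => simp only [tmul_add, map_add, mul_add, hx, hy]
  have h₂ : (LinearMap.rTensor B (LinearMap.mul' k P)) ∘ₗ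
      (TensorProduct.assoc k P P B).symm.toLinearMap ∘ₗ
      LinearMap.rTensor (P ⊗[k] B) (HopfAlgebra.antipode (R := k) (A := P)) ∘ₗ
      (TensorProduct.assoc k P P B).toLinearMap ∘ₗ
        LinearMap.rTensor B (Coalgebra.comul (R := k) (A := P)) =
      LinearMap.rTensor B (Algebra.linearMap k P) ∘ₗ
        LinearMap.rTensor B (Coalgebra.counit (R := k) (A := P)) := by
    refine TensorProduct.ext' fun p b => ?_
    simp only [LinearMap.comp_apply, LinearMap.rTensor_tmul, Algebra.linearMap_apply,
      ← HopfAlgebra.mul_antipode_rTensor_comul_apply]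
    induction Coalgebra.comul (R := k) p using TensorProduct.induction_on with
    | zero => simp
    | tmul x y => simp
    | add x y hx hy => simp only [add_tmul, map_add, hx, hy]
  refine (LinearMap.congr_fun h₁ (δ c)).trans ?_
  have h' := LinearMap.congr_fun h₂ (δ c)
  simpa only [LinearMap.comp_apply, LinearEquiv.coe_coe, hδ.counit_rTensor, ← hδ.2,
    LinearMap.rTensor_tmul, Algebra.linearMap_apply, _root_.map_one] using h'

lemma psiExt_phiExt (hδ : IsLeftCoaction (H := P) δ) (z : P ⊗[k] B) :
    psiExt δ (phiExt δ z) = z := by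
  induction z using TensorProduct.induction_on with
  | zero => simp
  | tmul p c => simp [psiExt_mul, psiExt_coaction hδ]
  | add x y hx hy => simp only [map_add, hx, hy]

lemma phiExt_psiExt (hδ : IsLeftCoaction (H := P) δ) (z : P ⊗[k] B) :
    phiExt δ (psiExt δ z) = z := by
  induction z using TensorProduct.induction_on with
  | zero => simp
  | tmul p c => simp [psiExt_tmul, phiExt_mul, phiExt_antipode_coaction hδ]
  | add x y hx hy => simp only [map_add, hx, hy]

/-- `p₁ ⊗ π(p₂) π(S(p₃)) = p ⊗ 1`. -/
lemma piCoact_antipode (π : P →ₐc[k] H) (p : P) :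
    LinearMap.lTensor P (LinearMap.mul' k H) (TensorProduct.assoc k P H H
      (TensorProduct.map (piCoact π) ((π : P →ₗ[k] H) ∘ₗ HopfAlgebra.antipode (R := k) (A := P))
        (Coalgebra.comul (R := k) p))) = p ⊗ₜ 1 := by
  have h₁ : LinearMap.lTensor P (LinearMap.mul' k H) ∘ₗ
      (TensorProduct.assoc k P H H).toLinearMap ∘ₗ
      TensorProduct.map (piCoact π) ((π : P →ₗ[k] H) ∘ₗ HopfAlgebra.antipode (R := k) (A := P)) =
      LinearMap.lTensor P ((π : P →ₗ[k] H) ∘ₗ LinearMap.mul' k P ∘ₗ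
        LinearMap.lTensor P (HopfAlgebra.antipode (R := k) (A := P))) ∘ₗ
      (TensorProduct.assoc k P P P).toLinearMap ∘ₗ
        LinearMap.rTensor P (Coalgebra.comul (R := k) (A := P)) := by
    refine TensorProduct.ext' fun p q => ?_
    simp only [LinearMap.comp_apply, LinearMap.rTensor_tmul, TensorProduct.map_tmul, piCoact]
    induction Coalgebra.comul (R := k) p using TensorProduct.induction_on with
    | zero => simp
    | tmul x y => simp
    | add x y hx hy => simp only [add_tmul, map_add, hx, hy]
  have h₂ : ((π : P →ₗ[k] H) ∘ₗ LinearMap.mul' k P ∘ₗ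
        LinearMap.lTensor P (HopfAlgebra.antipode (R := k) (A := P))) ∘ₗ
        Coalgebra.comul (R := k) (A := P) =
      Algebra.linearMap k H ∘ₗ Coalgebra.counit (R := k) (A := P) := by
    ext x
    simpa [HopfAlgebra.mul_antipode_lTensor_comul_apply] using
      AlgHomClass.commutes π (Coalgebra.counit (R := k) x)
  refine (LinearMap.congr_fun h₁ (Coalgebra.comul (R := k) p)).trans ?_
  simp only [LinearMap.comp_apply, LinearEquiv.coe_coe, Coalgebra.coassoc_apply]
  rw [← LinearMap.comp_apply, ← LinearMap.lTensor_comp, h₂, LinearMap.lTensor_comp,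
    LinearMap.comp_apply, Coalgebra.lTensor_counit_comul]
  simp

variable (π) in
/-- The right `H`-coaction `p ⊗ c ↦ (p₁ ⊗ c) ⊗ π(p₂)` on `P ⊗ B` through the factor `P`. -/
def leftFactorCoact : P ⊗[k] B →ₗ[k] (P ⊗[k] B) ⊗[k] H :=
  (TensorProduct.rightComm k P H B).toLinearMap ∘ₗ
    LinearMap.rTensor B (piCoact π)

/-- `p₁ ⊗ π(p₂)` placed in `(P ⊗ B) ⊗ H`. -/
lemma leftFactorCoact_tmul_one (p : P) : leftFactorCoact π (p ⊗ₜ 1) =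
    Algebra.TensorProduct.map (Algebra.TensorProduct.includeLeft (R := k) (S := k)
      (A := P) (B := B)) (AlgHom.id k H) (piCoact π p) := by
  simp only [leftFactorCoact, LinearMap.comp_apply, LinearMap.rTensor_tmul, LinearEquiv.coe_coe]
  induction piCoact π p using TensorProduct.induction_on with
  | zero => simp only [zero_tmul, map_zero]
  | tmul x y => simp
  | add x y hx hy => simp only [add_tmul, map_add, hx, hy]

lemma piCoact_mul (p q : P) : piCoact π (p * q) = piCoact π p * piCoact π q := by
  simp only [piCoact, LinearMap.comp_apply, Bialgebra.comul_mul, lTensor_pi_eq,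
    AlgHom.toLinearMap_apply, map_mul]

lemma prodCoact_tmul (ρB : B →ₗ[k] B ⊗[k] H) (p : P) (c : B) :
    prodCoact π ρB (p ⊗ₜ c) = leftFactorCoact π (p ⊗ₜ 1) *
      Algebra.TensorProduct.map (Algebra.TensorProduct.includeRight (R := k)
        (A := P) (B := B)) (AlgHom.id k H) (ρB c) := by
  rw [leftFactorCoact_tmul_one]
  simp only [prodCoact, LinearMap.comp_apply, TensorProduct.map_tmul, LinearEquiv.coe_coe]
  induction piCoact π p using TensorProduct.induction_on with
  | zero => simp only [zero_tmul, map_zero, zero_mul]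
  | add x y hx hy => simp only [add_tmul, map_add, add_mul, hx, hy]
  | tmul x y =>
    induction ρB c using TensorProduct.induction_on with
    | zero => simp only [tmul_zero, map_zero, mul_zero]
    | add x y hx hy => simp only [tmul_add, map_add, mul_add, hx, hy]
    | tmul z w => simp

lemma prodCoact_mul (ρB : B →ₗ[k] B ⊗[k] H) (p : P)
    (t : P ⊗[k] B) :
    prodCoact π ρB ((p ⊗ₜ 1) * t) = leftFactorCoact π (p ⊗ₜ 1) * prodCoact π ρB t := by
  induction t using TensorProduct.induction_on with
  | zero => simp only [map_zero, mul_zero]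
  | add x y hx hy => simp only [map_add, mul_add, hx, hy]
  | tmul x c =>
    rw [Algebra.TensorProduct.tmul_mul_tmul, one_mul, prodCoact_tmul, prodCoact_tmul, ← mul_assoc]
    simp only [leftFactorCoact_tmul_one, piCoact_mul, map_mul]

variable (δ) in
variable (π) in
/-- The map `b ↦ b₂ ⊗ π(S(b₁))` attached to a left `P`-coaction on `B`. -/
def antipodeCoact : B →ₗ[k] B ⊗[k] H :=
  LinearMap.lTensor B ((π : P →ₗ[k] H) ∘ₗ (HopfAlgebra.antipode (R := k) (A := P))) ∘ₗ
    (TensorProduct.comm k P B).toLinearMap ∘ₗ δ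

/-- `B → P ⊗ B` lands in the coinvariants of `P ⊗ B`. -/
lemma prodCoact_coaction (hδ : IsLeftCoaction (H := P) δ)
    (c : B) : prodCoact π (antipodeCoact π δ) (δ c) = δ c ⊗ₜ 1 := by
  have h₁ : prodCoact π (antipodeCoact π δ) =
      (LinearMap.lTensor (P ⊗[k] B) (LinearMap.mul' k H)) ∘ₗ
      (tensorTensorTensorComm k P H B H).toLinearMap ∘ₗ
      TensorProduct.map (piCoact π) (LinearMap.lTensor B
        ((π : P →ₗ[k] H) ∘ₗ (HopfAlgebra.antipode (R := k) (A := P))) ∘ₗ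
          (TensorProduct.comm k P B).toLinearMap) ∘ₗ
      LinearMap.lTensor P δ := by
    rw [prodCoact, LinearMap.map_comp_lTensor, antipodeCoact, LinearMap.comp_assoc]
  have h₂ : (LinearMap.lTensor (P ⊗[k] B) (LinearMap.mul' k H)) ∘ₗ
      (tensorTensorTensorComm k P H B H).toLinearMap ∘ₗ
      TensorProduct.map (piCoact π) (LinearMap.lTensor B
        ((π : P →ₗ[k] H) ∘ₗ (HopfAlgebra.antipode (R := k) (A := P))) ∘ₗ
          (TensorProduct.comm k P B).toLinearMap) ∘ₗ
      (TensorProduct.assoc k P P B).toLinearMap =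
      (TensorProduct.rightComm k P H B).toLinearMap ∘ₗ
      LinearMap.rTensor B (LinearMap.lTensor P (LinearMap.mul' k H) ∘ₗ
        (TensorProduct.assoc k P H H).toLinearMap ∘ₗ TensorProduct.map (piCoact π)
          ((π : P →ₗ[k] H) ∘ₗ HopfAlgebra.antipode (R := k) (A := P))) := by
    refine TensorProduct.ext_threefold fun p q b => ?_
    simp only [LinearMap.comp_apply, LinearMap.rTensor_tmul, LinearMap.lTensor_tmul,
      TensorProduct.map_tmul, LinearEquiv.coe_coe, TensorProduct.assoc_tmul,
      TensorProduct.comm_tmul]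
    induction piCoact π p using TensorProduct.induction_on with
    | zero => simp only [zero_tmul, map_zero]
    | add x y hx hy => simp only [add_tmul, map_add, hx, hy]
    | tmul x y => simp
  have h₃ : (TensorProduct.rightComm k P H B).toLinearMap ∘ₗ
      LinearMap.rTensor B (LinearMap.lTensor P (LinearMap.mul' k H) ∘ₗ
        (TensorProduct.assoc k P H H).toLinearMap ∘ₗ TensorProduct.map (piCoact π)
          ((π : P →ₗ[k] H) ∘ₗ HopfAlgebra.antipode (R := k) (A := P))) ∘ₗ
        LinearMap.rTensor B (Coalgebra.comul (R := k) (A := P)) =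
      (TensorProduct.mk k (P ⊗[k] B) H).flip 1 := by
    refine TensorProduct.ext' fun p b => ?_
    simp only [LinearMap.comp_apply, LinearMap.rTensor_tmul, LinearEquiv.coe_coe,
      piCoact_antipode]
    simp
  rw [h₁]
  simp only [LinearMap.comp_apply,
    hδ.2]
  refine (LinearMap.congr_fun h₂ (LinearMap.rTensor B
    (Coalgebra.comul (R := k) (A := P)) (δ c))).trans ?_
  exact LinearMap.congr_fun h₃ (δ c)

/-- `phiExt` intertwines the coaction through `P` with the tensor product coaction. -/
lemma prodCoact_phiExt (hδ : IsLeftCoaction (H := P) δ)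
    (z : P ⊗[k] B) :
    prodCoact π (antipodeCoact π δ) (phiExt δ z) =
      LinearMap.rTensor H (phiExt δ) (leftFactorCoact π z) := by
  induction z using TensorProduct.induction_on with
  | zero => simp only [map_zero]
  | add x y hx hy => simp only [map_add, hx, hy]
  | tmul p c =>
    rw [phiExt_tmul, prodCoact_mul, prodCoact_coaction hδ, leftFactorCoact_tmul_one]
    simp only [leftFactorCoact, LinearMap.comp_apply, LinearMap.rTensor_tmul, LinearEquiv.coe_coe]
    induction piCoact π p using TensorProduct.induction_on with
    | zero => simp only [zero_tmul, map_zero, zero_mul]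
    | add x y hx hy => simp only [add_tmul, map_add, add_mul, hx, hy]
    | tmul x y => simp

lemma regCoactTensor_mul (p : P) (t : P ⊗[k] B) :
    regCoactTensor B ((p ⊗ₜ 1) * t) =
      regCoactTensor B (p ⊗ₜ 1) * regCoactTensor B t := by
  induction t using TensorProduct.induction_on with
  | zero => simp only [map_zero, mul_zero]
  | add x y hx hy => simp only [map_add, mul_add, hx, hy]
  | tmul x c =>
    simp only [Algebra.TensorProduct.tmul_mul_tmul, one_mul, regCoactTensor, LinearMap.comp_apply,
      LinearMap.rTensor_tmul, LinearEquiv.coe_coe, Bialgebra.comul_mul]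
    induction Coalgebra.comul (R := k) p using TensorProduct.induction_on with
    | zero => simp only [zero_tmul, map_zero, zero_mul]
    | add x y hx hy => simp only [add_tmul, map_add, add_mul, hx, hy]
    | tmul x y =>
      induction Coalgebra.comul (R := k) (A := P) _ using TensorProduct.induction_on with
      | zero => simp only [zero_tmul, map_zero, mul_zero]
      | add x y hx hy => simp only [add_tmul, map_add, mul_add, hx, hy]
      | tmul z w => simp

lemma rTensor_mulLeft_apply (p : P) (t : P ⊗[k] B) :
    LinearMap.rTensor B (LinearMap.mulLeft k p) t = (p ⊗ₜ 1) * t := by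
  induction t using TensorProduct.induction_on with
  | zero => simp only [map_zero, mul_zero]
  | add x y hx hy => simp only [map_add, mul_add, hx, hy]
  | tmul x y => simp

lemma rTensor_mul_assoc_symm (i : B →ₗ[k] P) (b : B) (t : P ⊗[k] B) :
    LinearMap.rTensor B (LinearMap.mul' k P ∘ₗ LinearMap.rTensor P i)
      ((TensorProduct.assoc k B P B).symm (b ⊗ₜ t)) = (i b ⊗ₜ 1) * t := by
  induction t using TensorProduct.induction_on with
  | zero => simp only [tmul_zero, map_zero, mul_zero]
  | add x y hx hy => simp only [tmul_add, map_add, mul_add, hx, hy]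
  | tmul x y => simp

lemma lTensor_phiExt_mul (i : B →ₗ[k] P) (s t : P ⊗[k] B) :
    LinearMap.lTensor P (phiExt δ ∘ₗ LinearMap.rTensor B i)
      (LinearMap.rTensor (B ⊗[k] B) (LinearMap.mul' k P)
        (tensorTensorTensorComm k P B P B (s ⊗ₜ t))) =
      LinearMap.lTensor P (LinearMap.rTensor B i ∘ₗ (TensorProduct.mk k B B).flip 1) s *
        LinearMap.lTensor P δ t := by
  induction s using TensorProduct.induction_on with
  | zero => simp only [zero_tmul, map_zero, zero_mul]
  | add x y hx hy => simp only [add_tmul, map_add, add_mul, hx, hy]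
  | tmul x y =>
    induction t using TensorProduct.induction_on with
    | zero => simp only [tmul_zero, map_zero, mul_zero]
    | add x y hx hy => simp only [tmul_add, map_add, mul_add, hx, hy]
    | tmul z w => simp

lemma map_mul_tensorTensorTensorComm (s t : P ⊗[k] B) :
    TensorProduct.map (LinearMap.mul' k P) (LinearMap.mul' k B)
      (tensorTensorTensorComm k P B P B (s ⊗ₜ t)) = s * t := by
  induction s using TensorProduct.induction_on with
  | zero => simp only [zero_tmul, map_zero, zero_mul]
  | add x y hx hy => simp only [add_tmul, map_add, add_mul, hx, hy]
  | tmul x y =>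
    induction t using TensorProduct.induction_on with
    | zero => simp only [tmul_zero, map_zero, mul_zero]
    | add x y hx hy => simp only [tmul_add, map_add, mul_add, hx, hy]
    | tmul z w => simp

lemma regCoactTensor_embed (i : B →ₗ[k] P)
    (hi : LinearMap.lTensor P i ∘ₗ δ = Coalgebra.comul (R := k) (A := P) ∘ₗ i) (b : B) :
    regCoactTensor B (i b ⊗ₜ (1 : B)) =
      LinearMap.lTensor P (LinearMap.rTensor B i ∘ₗ (TensorProduct.mk k B B).flip 1) (δ b) := by
  have hb : Coalgebra.comul (R := k) (i b) = LinearMap.lTensor P i (δ b) :=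
    (LinearMap.congr_fun hi b).symm
  simp only [regCoactTensor, LinearMap.comp_apply, LinearMap.rTensor_tmul, hb,
    LinearEquiv.coe_coe]
  induction δ b using TensorProduct.induction_on with
  | zero => simp only [zero_tmul, map_zero]
  | add x y hx hy => simp only [add_tmul, map_add, hx, hy]
  | tmul x y => simp

/-- `phiExt` intertwines the left coactions of `B ⊗ B` and `P ⊗ B`. -/
lemma regCoactTensor_phiExt (hδ : IsLeftCoaction (H := P) δ) (i : B →ₗ[k] P)
    (hi : LinearMap.lTensor P i ∘ₗ δ = Coalgebra.comul (R := k) (A := P) ∘ₗ i) (b c : B) :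
    regCoactTensor B (phiExt δ (i b ⊗ₜ c)) =
      LinearMap.lTensor P (phiExt δ ∘ₗ LinearMap.rTensor B i)
        (LinearMap.rTensor (B ⊗[k] B) (LinearMap.mul' k P)
          (tensorTensorTensorComm k P B P B (δ b ⊗ₜ δ c))) := by
  rw [phiExt_tmul, regCoactTensor_mul, regCoactTensor_embed i hi, lTensor_phiExt_mul, hδ.2]
  rfl

end LeftCoaction

variable (π)

lemma lTensor_qhsIncl_injective (M : Type) [AddCommGroup M] [Module k M] :
    Function.Injective (LinearMap.lTensor M (qhsIncl π)) :=
  Module.Flat.lTensor_preserves_injective_linearMap _ Subtype.val_injective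

lemma rTensor_qhsIncl_injective (M : Type) [AddCommGroup M] [Module k M] :
    Function.Injective (LinearMap.rTensor M (qhsIncl π)) :=
  Module.Flat.rTensor_preserves_injective_linearMap _ Subtype.val_injective

variable {π coactB}

namespace IsRestrictedComul

lemma lTensor_incl_apply (hco : IsRestrictedComul π coactB) (b : qhsAlg π) :
    LinearMap.lTensor P (qhsIncl π) (coactB b) = Coalgebra.comul (R := k) (b : P) :=
  LinearMap.congr_fun hco b

/-- The restricted comultiplication `B → P ⊗ B` is coassociative. -/
lemma coassoc (hco : IsRestrictedComul π coactB) (b : qhsAlg π) :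
    LinearMap.lTensor P coactB (coactB b) =
      TensorProduct.assoc k P P (qhsAlg π)
        (LinearMap.rTensor (qhsAlg π) (Coalgebra.comul (R := k) (A := P)) (coactB b)) := by
  apply Module.Flat.lTensor_preserves_injective_linearMap (M := P) _
    (lTensor_qhsIncl_injective π P)
  have h₁ : LinearMap.lTensor P (LinearMap.lTensor P (qhsIncl π)) ∘ₗ LinearMap.lTensor P coactB =
      LinearMap.lTensor P (Coalgebra.comul (R := k) (A := P)) ∘ₗ
        LinearMap.lTensor P (qhsIncl π) := by
    rw [← LinearMap.lTensor_comp, hco, LinearMap.lTensor_comp]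
  have h₂ : LinearMap.lTensor P (LinearMap.lTensor P (qhsIncl π)) ∘ₗ
      (TensorProduct.assoc k P P (qhsAlg π)).toLinearMap ∘ₗ
        LinearMap.rTensor (qhsAlg π) (Coalgebra.comul (R := k) (A := P)) =
      (TensorProduct.assoc k P P P).toLinearMap ∘ₗ
        LinearMap.rTensor P (Coalgebra.comul (R := k) (A := P)) ∘ₗ
          LinearMap.lTensor P (qhsIncl π) := by
    refine TensorProduct.ext' fun p b => ?_
    simp only [LinearMap.comp_apply, LinearMap.rTensor_tmul, LinearMap.lTensor_tmul]
    induction Coalgebra.comul (R := k) p using TensorProduct.induction_on with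
    | zero => simp
    | tmul x y => simp
    | add x y hx hy => simp only [add_tmul, map_add, hx, hy]
  refine (LinearMap.congr_fun h₁ (coactB b)).trans
    (Eq.trans ?_ (LinearMap.congr_fun h₂ (coactB b)).symm)
  simp only [LinearMap.comp_apply, LinearEquiv.coe_coe, hco.lTensor_incl_apply,
    Coalgebra.coassoc_apply]

/-- The restricted comultiplication is a left `P`-coaction on `B`. -/
lemma isLeftCoaction (hco : IsRestrictedComul π coactB) : IsLeftCoaction (H := P) coactB := by
  refine ⟨fun b => ?_, hco.coassoc⟩
  suffices hb : LinearMap.rTensor (qhsAlg π) (Coalgebra.counit (R := k) (A := P)) (coactB b) =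
      (1 : k) ⊗ₜ b by rw [hb, TensorProduct.lid_tmul, one_smul]
  apply lTensor_qhsIncl_injective π k
  have h : LinearMap.lTensor k (qhsIncl π) ∘ₗ
      LinearMap.rTensor (qhsAlg π) (Coalgebra.counit (R := k) (A := P)) =
      LinearMap.rTensor P (Coalgebra.counit (R := k) (A := P)) ∘ₗ
        LinearMap.lTensor P (qhsIncl π) := by
    rw [LinearMap.lTensor_comp_rTensor, LinearMap.rTensor_comp_lTensor]
  refine (LinearMap.congr_fun h (coactB b)).trans ?_
  rw [LinearMap.comp_apply, hco.lTensor_incl_apply, Coalgebra.rTensor_counit_comul]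
  rfl

/-- The restricted comultiplication `B → P ⊗ B` is multiplicative. -/
lemma map_mul (hco : IsRestrictedComul π coactB) (b c : qhsAlg π) :
    coactB (b * c) = coactB b * coactB c := by
  apply lTensor_qhsIncl_injective π P
  have h : ∀ t, LinearMap.lTensor P (qhsIncl π) t =
      Algebra.TensorProduct.map (AlgHom.id k P) (qhsAlg π).val t := fun t => rfl
  have h' : ∀ b, Algebra.TensorProduct.map (AlgHom.id k P) (qhsAlg π).val (coactB b) =
      Coalgebra.comul (R := k) (b : P) := hco.lTensor_incl_apply
  rw [hco.lTensor_incl_apply, h, _root_.map_mul, h', h', Subalgebra.coe_mul, Bialgebra.comul_mul]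

/-- A right coaction on `B` restricting `a ↦ a₂ ⊗ π(S(a₁))` is determined by `coactB`. -/
lemma eq_antipodeCoact (hco : IsRestrictedComul π coactB)
    {ρB : (qhsAlg π) →ₗ[k] (qhsAlg π) ⊗[k] H}
    (hρB : (LinearMap.rTensor H (qhsIncl π)) ∘ₗ ρB = adCoact₀ π ∘ₗ (qhsIncl π)) :
    ρB = antipodeCoact π coactB := by
  ext1 b
  apply rTensor_qhsIncl_injective π H
  refine (LinearMap.congr_fun hρB b).trans ?_
  have h : LinearMap.rTensor H (qhsIncl π) ∘ₗ LinearMap.lTensor (qhsAlg π)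
      ((π : P →ₗ[k] H) ∘ₗ (HopfAlgebra.antipode (R := k) (A := P))) ∘ₗ
        (TensorProduct.comm k P (qhsAlg π)).toLinearMap =
      LinearMap.lTensor P ((π : P →ₗ[k] H) ∘ₗ (HopfAlgebra.antipode (R := k) (A := P))) ∘ₗ
        (TensorProduct.comm k P P).toLinearMap ∘ₗ LinearMap.lTensor P (qhsIncl π) :=
    TensorProduct.ext' fun p b => by simp
  refine Eq.trans ?_ (LinearMap.congr_fun h (coactB b)).symm
  simp only [adCoact₀, LinearMap.comp_apply, hco.lTensor_incl_apply]
  rfl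

end IsRestrictedComul

variable (coactB) in
lemma phiMap_eq : phiMap π coactB =
    phiExt coactB ∘ₗ LinearMap.rTensor (qhsAlg π) (qhsIncl π) :=
  TensorProduct.ext' fun b c =>
    (rTensor_mul_assoc_symm (qhsIncl π) b (coactB c)).trans (phiExt_tmul coactB _ c).symm

/-- `B ⊗ B` is the subspace of coinvariants for the coaction of `P ⊗ B` through `P`. -/
lemma leftFactorCoact_eq_iff (z : P ⊗[k] (qhsAlg π)) :
    leftFactorCoact π z = z ⊗ₜ 1 ↔
      z ∈ LinearMap.range (LinearMap.rTensor (qhsAlg π) (qhsIncl π)) := by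
  have hex : Function.Exact (qhsIncl π) (piCoact π - (TensorProduct.mk k P H).flip 1) := by
    intro p
    change p ∈ qhsAlg π ↔ p ∈ Set.range ((↑) : qhsAlg π → P)
    rw [Subtype.range_coe, SetLike.mem_coe]
  have hex' := Module.Flat.rTensor_exact (qhsAlg π) hex
  rw [LinearMap.mem_range, ← Set.mem_range, ← hex' z, LinearMap.rTensor_sub, LinearMap.sub_apply,
    sub_eq_zero, ← (TensorProduct.rightComm k P H (qhsAlg π)).injective.eq_iff]
  have h : (TensorProduct.rightComm k P H (qhsAlg π)).toLinearMap ∘ₗ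
      LinearMap.rTensor (qhsAlg π) ((TensorProduct.mk k P H).flip 1) =
      (TensorProduct.mk k (P ⊗[k] (qhsAlg π)) H).flip 1 :=
    TensorProduct.ext' fun p b => by simp
  exact Eq.congr_right (LinearMap.congr_fun h z).symm

lemma mem_rightCoinv {Y : Type} [AddCommGroup Y] [Module k Y] (ρ : Y →ₗ[k] Y ⊗[k] H) (y : Y) :
    y ∈ rightCoinv ρ ↔ ρ y = y ⊗ₜ 1 := by
  simp [rightCoinv, sub_eq_zero]

lemma phiExt_mem_rightCoinv_iff (hco : IsRestrictedComul π coactB)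
    {ρB : (qhsAlg π) →ₗ[k] (qhsAlg π) ⊗[k] H}
    (hρB : (LinearMap.rTensor H (qhsIncl π)) ∘ₗ ρB = adCoact₀ π ∘ₗ (qhsIncl π))
    (z : P ⊗[k] (qhsAlg π)) :
    phiExt coactB z ∈ rightCoinv (prodCoact π ρB) ↔
      z ∈ LinearMap.range (LinearMap.rTensor (qhsAlg π) (qhsIncl π)) := by
  have hinj : Function.Injective (LinearMap.rTensor H (phiExt coactB)) :=
    Module.Flat.rTensor_preserves_injective_linearMap _
      (Function.LeftInverse.injective (psiExt_phiExt hco.isLeftCoaction))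
  rw [hco.eq_antipodeCoact hρB, mem_rightCoinv, prodCoact_phiExt hco.isLeftCoaction,
    ← LinearMap.rTensor_tmul, hinj.eq_iff, leftFactorCoact_eq_iff]

end BBIso

/-- The map `Φ : B ⊗ B → (P ⊗ B)ᴴ`, `b ⊗ c ↦ bc₁ ⊗ c₂`, is a
bijection onto the coinvariants of the tensor product `H`-coaction on `P ⊗ B`,
with inverse induced by `Ψ : p ⊗ b ↦ pS(b₁) ⊗ b₂`; moreover it is an isomorphism
of left `P`-covariant `B`-bimodules. -/
theorem bb_iso_coinvariants (hπ : Function.Surjective π)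
    (hco : IsRestrictedComul π coactB)
    (ρB : (qhsAlg π) →ₗ[k] (qhsAlg π) ⊗[k] H)
    (hρB : (LinearMap.rTensor H (qhsIncl π)) ∘ₗ ρB = adCoact₀ π ∘ₗ (qhsIncl π)) :
    Function.Injective (phiMap π coactB) ∧
    LinearMap.range (phiMap π coactB) = rightCoinv (prodCoact π ρB) ∧
    -- Ψ is inverse to Φ
    (∀ w : (qhsAlg π) ⊗[k] (qhsAlg π),
      psiMap π coactB (phiMap π coactB w) =
        (LinearMap.rTensor (qhsAlg π) (qhsIncl π)) w) ∧
    (∀ z ∈ rightCoinv (prodCoact π ρB),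
      psiMap π coactB z ∈
        LinearMap.range (LinearMap.rTensor (qhsAlg π) (qhsIncl π))) ∧
    -- Φ intertwines the left P-coactions
    (regCoactTensor (qhsAlg π) ∘ₗ phiMap π coactB =
      (LinearMap.lTensor P (phiMap π coactB)) ∘ₗ lamBB π coactB) ∧
    -- Φ intertwines the left regular B-actions
    (∀ (b' b c : qhsAlg π),
      phiMap π coactB ((b' * b) ⊗ₜ c) =
        (LinearMap.rTensor (qhsAlg π) (LinearMap.mulLeft k ((b' : P))))
          (phiMap π coactB (b ⊗ₜ c))) ∧
    -- Φ intertwines the right B-actions, where (p ⊗ b) ◁ b' = pb'₁ ⊗ bb'₂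
    (∀ (b c b' : qhsAlg π),
      phiMap π coactB (b ⊗ₜ (c * b')) =
        prodRact π coactB (LinearMap.mul' k (qhsAlg π))
          (phiMap π coactB (b ⊗ₜ c) ⊗ₜ b')) := by
  have hδ := hco.isLeftCoaction
  have hψ : psiMap π coactB = psiExt coactB := rfl
  have hΨΦ : ∀ w : (qhsAlg π) ⊗[k] (qhsAlg π), psiMap π coactB (phiMap π coactB w) =
      LinearMap.rTensor (qhsAlg π) (qhsIncl π) w := fun w => by
    rw [hψ, phiMap_eq, LinearMap.comp_apply, psiExt_phiExt hδ]
  have hΨ : ∀ z ∈ rightCoinv (prodCoact π ρB), psiMap π coactB z ∈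
      LinearMap.range (LinearMap.rTensor (qhsAlg π) (qhsIncl π)) := fun z hz => by
    rwa [← phiExt_mem_rightCoinv_iff hco hρB, hψ, phiExt_psiExt hδ]
  have hΦ : ∀ b c : qhsAlg π, phiMap π coactB (b ⊗ₜ c) = ((b : P) ⊗ₜ 1) * coactB c :=
    fun b c => by
      rw [phiMap_eq, LinearMap.comp_apply, LinearMap.rTensor_tmul, phiExt_tmul]
      rfl
  refine ⟨fun v w hvw => ?_, ?_, hΨΦ, hΨ, TensorProduct.ext' fun b c => ?_,
    fun b' b c => ?_, fun b c b' => ?_⟩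
  · apply rTensor_qhsIncl_injective π
    rw [← hΨΦ, ← hΨΦ, hvw]
  · ext z
    constructor
    · rintro ⟨w, rfl⟩
      rw [phiMap_eq, LinearMap.comp_apply, phiExt_mem_rightCoinv_iff hco hρB]
      exact ⟨w, rfl⟩
    · intro hz
      obtain ⟨w, hw⟩ := hΨ z hz
      exact ⟨w, by rw [phiMap_eq, LinearMap.comp_apply, hw, hψ, phiExt_psiExt hδ]⟩
  · rw [phiMap_eq]
    exact regCoactTensor_phiExt hδ (qhsIncl π) hco b c
  · rw [hΦ, hΦ, rTensor_mulLeft_apply, ← mul_assoc, Algebra.TensorProduct.tmul_mul_tmul, one_mul,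
      Subalgebra.coe_mul]
  · rw [hΦ, hΦ, hco.map_mul, ← mul_assoc]
    exact (map_mul_tensorTensorTensorComm _ _).symm
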